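/- arXiv:2012.13069 — 2 statements merged into one kernel-verified Lean document; each statement's English description precedes it below -/
import Mathlib

section
/- Let n ≥ 3 and let R₀ : ℝ^n → ℝ be continuous with R₀(x) ≥ 0 for all x. Let v : ℝ^n → ℝ be a C² function with v > 0 on ℝ^n, satisfying −c_n Δv + R₀ v = R₀ on all of ℝ^n and v(x) → 0 as x → ∞. Then v(x) < 1 for every x ∈ ℝ^n; in particular sup v ≤ 1. -/
open Filter

/-- The Euclidean Laplacian on `ℝ^n`: the sum of the second partial derivatives. -/
noncomputable def lap {n : ℕ} (f : EuclideanSpace ℝ (Fin n) → ℝ)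
    (x : EuclideanSpace ℝ (Fin n)) : ℝ :=
  ∑ i, fderiv ℝ (fun y => fderiv ℝ f y (EuclideanSpace.single i 1)) x (EuclideanSpace.single i 1)

/-- The necessary second-order condition at a local maximum. -/
theorem deriv_deriv_nonpos_of_isLocalMax {f : ℝ → ℝ} {a : ℝ} (h : IsLocalMax f a)
    (hc : ContinuousAt f a) : deriv (deriv f) a ≤ 0 := by
  by_contra! hpos
  have hmin : IsLocalMin f a := isLocalMin_of_deriv_deriv_pos hpos h.deriv_eq_zero hc
  have hconst : f =ᶠ[nhds a] fun _ => f a := by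
    filter_upwards [h, hmin] with x h₁ h₂ using le_antisymm h₁ h₂
  have hzero : deriv (deriv f) a = 0 := by
    rw [hconst.deriv.deriv_eq]
    simp
  exact hpos.ne' hzero

section Laplacian

variable {n : ℕ} {f g : EuclideanSpace ℝ (Fin n) → ℝ}

theorem ContDiff.differentiable_fderiv_apply (hf : ContDiff ℝ 2 f)
    (e : EuclideanSpace ℝ (Fin n)) : Differentiable ℝ fun y => fderiv ℝ f y e :=
  ((hf.fderiv_right (m := 1) (by norm_num)).clm_apply contDiff_const).differentiable (by norm_num)

/-- The Laplacian is nonpositive at a local maximum. -/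
theorem lap_nonpos_of_isLocalMax (hf : ContDiff ℝ 2 f) {p : EuclideanSpace ℝ (Fin n)}
    (h : IsLocalMax f p) : lap f p ≤ 0 := by
  refine Finset.sum_nonpos fun i _ => ?_
  set e : EuclideanSpace ℝ (Fin n) := EuclideanSpace.single i 1
  have hline (t : ℝ) : HasDerivAt (fun t : ℝ => p + t • e) e t := by
    simpa using ((hasDerivAt_id t).smul_const e).const_add p
  have h₁ : deriv (fun t : ℝ => f (p + t • e)) = fun t => fderiv ℝ f (p + t • e) e :=
    funext fun t => ((hf.differentiable (by norm_num) _).hasFDerivAt.comp_hasDerivAt t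
      (hline t)).deriv
  have h₂ : deriv (fun t : ℝ => fderiv ℝ f (p + t • e) e) 0 =
      fderiv ℝ (fun y => fderiv ℝ f y e) p e := by
    simpa [Function.comp_def] using
      ((hf.differentiable_fderiv_apply e (p + (0 : ℝ) • e)).hasFDerivAt.comp_hasDerivAt (0 : ℝ)
        (hline 0)).deriv
  have hcont : ContinuousAt (fun t : ℝ => p + t • e) 0 := (hline 0).continuousAt
  have hmax : IsLocalMax (fun t : ℝ => f (p + t • e)) 0 := by
    have ht : Tendsto (fun t : ℝ => p + t • e) (nhds 0) (nhds p) := by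
      simpa [ContinuousAt] using hcont
    filter_upwards [ht.eventually h] with t ht
    simpa using ht
  have key := deriv_deriv_nonpos_of_isLocalMax hmax
    (hf.continuous.continuousAt.comp (f := fun t : ℝ => p + t • e) hcont)
  rwa [h₁, h₂] at key

theorem lap_add (hf : ContDiff ℝ 2 f) (hg : ContDiff ℝ 2 g) (x : EuclideanSpace ℝ (Fin n)) :
    lap (fun y => f y + g y) x = lap f x + lap g x := by
  simp only [lap, ← Finset.sum_add_distrib]
  refine Finset.sum_congr rfl fun i _ => ?_
  have h₁ : (fun y => fderiv ℝ (fun y => f y + g y) y (EuclideanSpace.single i 1)) =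
      fun y => fderiv ℝ f y (EuclideanSpace.single i 1) +
        fderiv ℝ g y (EuclideanSpace.single i 1) := by
    funext y
    rw [fderiv_fun_add (hf.differentiable (by norm_num) y) (hg.differentiable (by norm_num) y)]
    rfl
  rw [h₁, fderiv_fun_add (hf.differentiable_fderiv_apply _ x) (hg.differentiable_fderiv_apply _ x)]
  rfl

theorem lap_exp_coord (i : Fin n) (a b : ℝ) (x : EuclideanSpace ℝ (Fin n)) :
    lap (fun y => b * Real.exp (a * y i)) x = a ^ 2 * (b * Real.exp (a * x i)) := by
  have hd (b : ℝ) (j : Fin n) (y : EuclideanSpace ℝ (Fin n)) :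
      fderiv ℝ (fun y : EuclideanSpace ℝ (Fin n) => b * Real.exp (a * y i)) y
        (EuclideanSpace.single j 1) = (if i = j then a * b else 0) * Real.exp (a * y i) := by
    have h := (((EuclideanSpace.proj i : EuclideanSpace ℝ (Fin n) →L[ℝ] ℝ).hasFDerivAt
      (x := y)).const_mul a).exp.const_mul b
    have h' := congrArg (fun L => L (EuclideanSpace.single j 1)) h.fderiv
    refine h'.trans ?_
    by_cases hij : i = j
    · simp [hij]
      ring
    · simp [hij]
  simp only [lap, hd]
  simp
  ring

end Laplacian

/-- A positive `C²` solution of `-c_n Δv + R₀ v = R₀` on `ℝ^n` (with `R₀ ≥ 0` continuous)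
tending to `0` at infinity satisfies `v < 1` everywhere; in particular `sup v ≤ 1`. -/
theorem solution_lt_one (n : ℕ) (hn : 3 ≤ n)
    (R₀ : EuclideanSpace ℝ (Fin n) → ℝ) (hR₀c : Continuous R₀) (hR₀ : ∀ x, 0 ≤ R₀ x)
    (v : EuclideanSpace ℝ (Fin n) → ℝ) (hv : ContDiff ℝ 2 v) (hvpos : ∀ x, 0 < v x)
    (heq : ∀ x, -(4 * ((n : ℝ) - 1) / ((n : ℝ) - 2)) * lap v x + R₀ x * v x = R₀ x)
    (hlim : Tendsto v (cocompact (EuclideanSpace ℝ (Fin n))) (nhds 0)) :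
    (∀ x, v x < 1) ∧ (⨆ x, v x) ≤ 1 := by
  have hn' : (3 : ℝ) ≤ n := by exact_mod_cast hn
  set c : ℝ := 4 * ((n : ℝ) - 1) / ((n : ℝ) - 2)
  have hc : 0 < c := div_pos (by linarith) (by linarith)
  have hlt : ∀ x, v x < 1 := by
    intro z
    by_contra! hz
    obtain ⟨r, hr⟩ := Metric.closedBall_compl_subset_of_mem_cocompact
      (hlim.eventually (gt_mem_nhds (by norm_num : (0 : ℝ) < 1 / 2))) 0
    have hsmall (x : EuclideanSpace ℝ (Fin n)) (hx : r < ‖x‖) : v x < 1 / 2 :=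
      hr (by simpa using hx)
    have hzr : ‖z‖ ≤ r := by
      by_contra! h
      linarith [hsmall z h]
    have hB : IsCompact (Metric.closedBall (0 : EuclideanSpace ℝ (Fin n)) (r + 1)) :=
      isCompact_closedBall _ _
    have hzB : z ∈ Metric.closedBall (0 : EuclideanSpace ℝ (Fin n)) (r + 1) := by
      simp only [mem_closedBall_zero_iff]
      linarith
    obtain ⟨C, hC⟩ := hB.exists_bound_of_continuousOn hR₀c.continuousOn
    have hC0 : 0 ≤ C := (norm_nonneg _).trans (hC z hzB)
    let i : Fin n := ⟨0, by omega⟩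
    set a : ℝ := C / c + 1
    have ha : C < c * a ^ 2 := by
      have h₁ : c * a = C + c := by simp only [a]; field_simp
      have h₂ : 1 ≤ a := le_add_of_nonneg_left (by positivity)
      nlinarith
    have hexp : ContDiff ℝ 2 fun y : EuclideanSpace ℝ (Fin n) => Real.exp (a * y i) := by fun_prop
    obtain ⟨M, hM⟩ := hB.exists_bound_of_continuousOn hexp.continuous.continuousOn
    have hMpos : 0 < M := (norm_pos_iff.2 (Real.exp_ne_zero _)).trans_le (hM z hzB)
    set ε : ℝ := 1 / (2 * M)
    have hε : 0 < ε := by positivity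
    -- A maximum of `v + ε exp (a xᵢ)` over the ball violates the equation.
    let g : EuclideanSpace ℝ (Fin n) → ℝ := fun y => v y + ε * Real.exp (a * y i)
    have hg : ContDiff ℝ 2 g := hv.add (contDiff_const.mul hexp)
    obtain ⟨p, hpB, hp⟩ := hB.exists_isMaxOn ⟨z, hzB⟩ hg.continuous.continuousOn
    have hgp : 1 < g p := by
      have h₁ : g z ≤ g p := hp hzB
      have h₂ : 0 < ε * Real.exp (a * z i) := by positivity
      have h₃ : g z = v z + ε * Real.exp (a * z i) := rfl
      linarith
    have hpr : ‖p‖ ≤ r := by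
      by_contra! h
      have h₁ : ε * Real.exp (a * p i) ≤ 1 / 2 :=
        (mul_le_mul_of_nonneg_left ((Real.le_norm_self _).trans (hM p hpB)) hε.le).trans_eq
          (by simp only [ε]; field_simp)
      have h₂ : g p = v p + ε * Real.exp (a * p i) := rfl
      linarith [hsmall p h]
    have hmax : IsLocalMax g p :=
      hp.isLocalMax (mem_of_superset (Metric.isOpen_ball.mem_nhds
        (by simp only [mem_ball_zero_iff]; linarith)) Metric.ball_subset_closedBall)
    have hlap : lap v p + a ^ 2 * (ε * Real.exp (a * p i)) ≤ 0 := by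
      have h := lap_nonpos_of_isLocalMax hg hmax
      rwa [lap_add hv (contDiff_const.mul hexp), lap_exp_coord] at h
    have hE : 0 < ε * Real.exp (a * p i) := by positivity
    have hRC : R₀ p ≤ C := (Real.le_norm_self _).trans (hC p hpB)
    have hvp : 1 - v p < ε * Real.exp (a * p i) := by
      have h : g p = v p + ε * Real.exp (a * p i) := rfl
      linarith
    have h₁ : R₀ p * (1 - v p) ≤ R₀ p * (ε * Real.exp (a * p i)) :=
      mul_le_mul_of_nonneg_left hvp.le (hR₀ p)
    have h₂ := mul_le_mul_of_nonneg_right hRC hE.le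
    have h₃ := mul_lt_mul_of_pos_right ha hE
    have h₄ := mul_nonpos_of_nonneg_of_nonpos hc.le hlap
    linarith [heq p]
  exact ⟨hlt, ciSup_le fun x => (hlt x).le⟩
end

section
/- Let n ≥ 3 and let R₀ : ℝ^n → ℝ be a smooth nonnegative function which is not identically zero. Suppose there exists a C² function u : ℝ^n → ℝ with u > 0, −c_n Δu = R₀ on all of ℝ^n, and u(x) → 0 as x → ∞. Then there exists a C² function v : ℝ^n → ℝ with 0 < v(x) ≤ u(x) for all x, satisfying −c_n Δv + R₀ v = R₀ on all of ℝ^n and v(x) → 0 as x → ∞. -/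
open Filter

section Auxiliary

open MeasureTheory Topology Metric
open scoped SchwartzMap ContDiff LineDeriv Laplacian

section LapAlgebra

variable {n : ℕ}

local notation "𝔼" => EuclideanSpace ℝ (Fin n)

theorem ContDiff.fderiv_apply_const {F : Type*} [NormedAddCommGroup F] [NormedSpace ℝ F]
    {f : EuclideanSpace ℝ (Fin n) → F} (hf : ContDiff ℝ 2 f) (e : EuclideanSpace ℝ (Fin n)) :
    ContDiff ℝ 1 (fun y => fderiv ℝ f y e) :=
  (hf.fderiv_right (m := 1) (by norm_num)).clm_apply contDiff_const

theorem continuous_lap {f : 𝔼 → ℝ} (hf : ContDiff ℝ 2 f) : Continuous (lap f) := by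
  unfold lap
  refine continuous_finsetSum _ fun i _ => ?_
  exact ((hf.fderiv_apply_const _).continuous_fderiv one_ne_zero).clm_apply continuous_const

theorem lap_sub {f g : 𝔼 → ℝ} (hf : ContDiff ℝ 2 f) (hg : ContDiff ℝ 2 g) (x : 𝔼) :
    lap (fun y => f y - g y) x = lap f x - lap g x := by
  unfold lap
  rw [← Finset.sum_sub_distrib]
  refine Finset.sum_congr rfl fun i _ => ?_
  have h : (fun y => fderiv ℝ (fun y => f y - g y) y (EuclideanSpace.single i 1)) =
      fun y => fderiv ℝ f y (EuclideanSpace.single i 1)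
        - fderiv ℝ g y (EuclideanSpace.single i 1) := by
    funext y
    rw [fderiv_fun_sub (hf.differentiable two_ne_zero y) (hg.differentiable two_ne_zero y)]
    rfl
  rw [h, fderiv_fun_sub ((hf.fderiv_apply_const _).differentiable one_ne_zero x)
    ((hg.fderiv_apply_const _).differentiable one_ne_zero x)]
  rfl

theorem lap_const (a : ℝ) (x : 𝔼) : lap (fun _ : 𝔼 => a) x = 0 := by
  simp [lap]

/-- The second derivative test: the Laplacian is nonnegative at a minimum. -/
theorem lap_nonneg_of_isMin {h : 𝔼 → ℝ} (hh : ContDiff ℝ 2 h) {x : 𝔼} (hx : ∀ y, h x ≤ h y) :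
    0 ≤ lap h x := by
  refine Finset.sum_nonneg fun i _ => ?_
  set e : 𝔼 := EuclideanSpace.single i 1
  set k : ℝ → ℝ := fun t => h (x + t • e) with hk
  have hline : ∀ t : ℝ, HasDerivAt (fun t : ℝ => x + t • e) e t := fun t => by
    simpa using ((hasDerivAt_id t).smul_const e).const_add x
  have h1 : ∀ t, HasDerivAt k (fderiv ℝ h (x + t • e) e) t := fun t =>
    ((hh.differentiable two_ne_zero (x + t • e)).hasFDerivAt).comp_hasDerivAt t (hline t)
  have h1' : deriv k = fun t => fderiv ℝ h (x + t • e) e := funext fun t => (h1 t).deriv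
  have h2 : HasDerivAt (deriv k) (fderiv ℝ (fun y => fderiv ℝ h y e) x e) 0 := by
    rw [h1']
    have hd := ((hh.fderiv_apply_const e).differentiable one_ne_zero (x + (0 : ℝ) • e)).hasFDerivAt
    have h3 := hd.comp_hasDerivAt (0 : ℝ) (hline 0)
    rw [zero_smul, add_zero] at h3
    exact h3
  by_contra hneg
  push Not at hneg
  have hmin : IsLocalMin k 0 := Eventually.of_forall fun t => by simpa [hk] using hx (x + t • e)
  have hmax : IsLocalMax k 0 := by
    refine isLocalMax_of_deriv_deriv_neg (by rwa [h2.deriv]) ?_ (h1 0).continuousAt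
    exact hmin.deriv_eq_zero
  have hc : k =ᶠ[𝓝 0] fun _ => k 0 := by
    filter_upwards [hmin, hmax] with t h3 h4 using le_antisymm h4 h3
  have hz : deriv (deriv k) 0 = 0 := by
    have := hc.deriv.deriv_eq
    simpa using this
  rw [h2.deriv] at hz
  exact absurd hz hneg.ne

/-- Maximum principle on the whole space for `a - Δ`, `a > 0`. -/
theorem nonneg_of_sub_lap_nonneg {h : 𝔼 → ℝ} (hh : ContDiff ℝ 2 h) {a L : ℝ} (ha : 0 < a)
    (hL : 0 ≤ L) (hlim : Tendsto h (cocompact 𝔼) (𝓝 L)) (hpos : ∀ x, 0 ≤ a * h x - lap h x)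
    (x : 𝔼) : 0 ≤ h x := by
  by_contra hx
  push Not at hx
  obtain ⟨y, hy⟩ := hh.continuous.exists_forall_le_of_isBounded x <| by
    have : ∀ᶠ z in cocompact 𝔼, h x < h z := hlim.eventually_const_lt (by linarith)
    obtain ⟨K, hK, hKs⟩ := mem_cocompact.1 this
    refine hK.isBounded.subset fun z hz => ?_
    by_contra hzK
    have : h x < h z := hKs hzK
    exact absurd hz (not_le.2 this)
  have h1 := lap_nonneg_of_isMin hh hy
  have h2 := hpos y
  have h3 := hy x
  nlinarith

/-- Solvability of `a w - Δ w = f` in the Schwartz space. -/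
theorem exists_schwartz_resolvent {a : ℝ} (ha : 0 < a) (f : 𝓢(𝔼, ℝ)) :
    ∃ w : 𝓢(𝔼, ℝ), ∀ x, a * w x - lap w x = f x := by
  have hp : (fun x : 𝔼 => a + (2 * Real.pi) ^ 2 * ‖x‖ ^ 2).HasTemperateGrowth := by fun_prop
  have hpos : ∀ x : 𝔼, 0 < a + (2 * Real.pi) ^ 2 * ‖x‖ ^ 2 := fun x => by positivity
  have hq : (fun x : 𝔼 => (a + (2 * Real.pi) ^ 2 * ‖x‖ ^ 2)⁻¹).HasTemperateGrowth := by
    have h1 := Function.hasTemperateGrowth_one_add_norm_sq_rpow 𝔼 (-1)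
    have h2 := (Function.HasTemperateGrowth.const (E := 𝔼) a⁻¹).mul
      (h1.comp ((2 * Real.pi / √a) • ContinuousLinearMap.id ℝ 𝔼).hasTemperateGrowth)
    have h3 : (fun x : 𝔼 => (a + (2 * Real.pi) ^ 2 * ‖x‖ ^ 2)⁻¹) = (fun _ => a⁻¹) *
        (fun x : 𝔼 => (1 + ‖x‖ ^ 2) ^ (-1 : ℝ)) ∘
          ((2 * Real.pi / √a) • ContinuousLinearMap.id ℝ 𝔼) := by
      funext x
      simp only [Pi.mul_apply, Function.comp_apply, _root_.smul_apply,
        ContinuousLinearMap.coe_id', id_eq, norm_smul, Real.rpow_neg_one]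
      rw [← mul_inv, mul_pow ‖_‖ ‖x‖, Real.norm_eq_abs, sq_abs, div_pow, Real.sq_sqrt ha.le]
      congr 1
      field_simp
    rw [h3]
    exact h2
  set F : 𝓢(𝔼, ℂ) := SchwartzMap.postcompCLM Complex.ofRealCLM f with hF
  set W : 𝓢(𝔼, ℂ) := SchwartzMap.fourierMultiplierCLM ℂ
    (fun x : 𝔼 => (a + (2 * Real.pi) ^ 2 * ‖x‖ ^ 2)⁻¹) F with hWdef
  have hW : a • W - Δ W = F := by
    have h1 : SchwartzMap.fourierMultiplierCLM ℂ (fun x : 𝔼 => a + (2 * Real.pi) ^ 2 * ‖x‖ ^ 2) W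
      = F := by
      rw [hWdef, SchwartzMap.fourierMultiplierCLM_fourierMultiplierCLM_apply hp hq]
      have : ((fun x : 𝔼 => a + (2 * Real.pi) ^ 2 * ‖x‖ ^ 2) *
          fun x : 𝔼 => (a + (2 * Real.pi) ^ 2 * ‖x‖ ^ 2)⁻¹) = fun _ => 1 := by
        funext x
        exact mul_inv_cancel₀ (hpos x).ne'
      rw [this, SchwartzMap.fourierMultiplierCLM_const]
      simp
    have h2 : (fun x : 𝔼 => a + (2 * Real.pi) ^ 2 * ‖x‖ ^ 2) = fun x => ∑ i : Fin 2,
        (![fun _ => a, ((2 * Real.pi) ^ 2) • fun x : 𝔼 => ‖x‖ ^ 2] : Fin 2 → 𝔼 → ℝ) i x := by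
      funext x
      simp
    have h3 : (fun x : 𝔼 => ‖x‖ ^ 2).HasTemperateGrowth := by fun_prop
    rw [h2, SchwartzMap.fourierMultiplierCLM_sum ℂ] at h1
    · rw [SchwartzMap.laplacian_eq_fourierMultiplierCLM, ← h1]
      simp [SchwartzMap.fourierMultiplierCLM_smul h3]
    · intro i _
      fin_cases i
      · exact Function.HasTemperateGrowth.const a
      · exact (Function.HasTemperateGrowth.const (E := 𝔼) ((2 * Real.pi) ^ 2)).mul h3
  refine ⟨SchwartzMap.postcompCLM Complex.reCLM W, fun x => ?_⟩
  have h1 := congrArg (fun φ : 𝓢(𝔼, ℂ) => (φ x).re) hW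
  have hd : ∀ (φ : 𝓢(𝔼, ℂ)) (e y : 𝔼), fderiv ℝ (fun z => (φ z).re) y e = (∂_{e} φ y).re := by
    intro φ e y
    have := (Complex.reCLM.hasFDerivAt.comp y (φ.differentiableAt (x := y)).hasFDerivAt).fderiv
    exact congrArg (fun L : 𝔼 →L[ℝ] ℝ => L e) this
  have h2 : lap (SchwartzMap.postcompCLM Complex.reCLM W) x = (Δ W x).re := by
    rw [SchwartzMap.laplacian_eq_sum (EuclideanSpace.basisFun (Fin n) ℝ), lap,
      _root_.sum_apply, Complex.re_sum]
    refine Finset.sum_congr rfl fun i _ => ?_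
    have h3 : ∀ y, fderiv ℝ (SchwartzMap.postcompCLM Complex.reCLM W : 𝔼 → ℝ) y
        (EuclideanSpace.single i 1) = (∂_{(EuclideanSpace.single i 1 : 𝔼)} W y).re := fun y =>
      hd W _ y
    simp_rw [h3, hd, EuclideanSpace.basisFun_apply]
  rw [h2]
  simpa [hF] using h1

end LapAlgebra

section Averages

variable {n : ℕ}

local notation "𝔼" => EuclideanSpace ℝ (Fin n)

variable {E₁ : Type*} [NormedAddCommGroup E₁] [NormedSpace ℝ E₁]

/-- The average of `g` at scale `s` around `x`, weighted by the kernel `k`. -/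
noncomputable def avg {n : ℕ} {E₁ : Type*} [NormedAddCommGroup E₁] [NormedSpace ℝ E₁]
    (k : EuclideanSpace ℝ (Fin n) → E₁) (g : EuclideanSpace ℝ (Fin n) → ℝ) (s : ℝ)
    (x : EuclideanSpace ℝ (Fin n)) : E₁ :=
  ∫ y, g (x - s • y) • k y

/-- Measurable functions that are bounded on every ball. -/
structure LocBdd {n : ℕ} (g : EuclideanSpace ℝ (Fin n) → ℝ) : Prop where
  meas : Measurable g
  bdd : ∀ r : ℝ, ∃ C, ∀ x, ‖x‖ ≤ r → |g x| ≤ C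

/-- Continuous functions vanishing outside the unit ball. -/
structure UnitKernel {n : ℕ} {E₁ : Type*} [NormedAddCommGroup E₁]
    (k : EuclideanSpace ℝ (Fin n) → E₁) : Prop where
  cont : Continuous k
  zero : ∀ y, 1 < ‖y‖ → k y = 0

theorem Continuous.locBdd {g : 𝔼 → ℝ} (hg : Continuous g) : LocBdd g where
  meas := hg.measurable
  bdd r := by
    obtain ⟨C, hC⟩ := (isCompact_closedBall (0 : 𝔼) r).exists_bound_of_continuousOn hg.continuousOn
    exact ⟨C, fun x hx => hC x (by simpa using hx)⟩

theorem LocBdd.bdd_nonneg {g : 𝔼 → ℝ} (hg : LocBdd g) (r : ℝ) :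
    ∃ C, 0 ≤ C ∧ ∀ x, ‖x‖ ≤ r → |g x| ≤ C := by
  obtain ⟨C, hC⟩ := hg.bdd r
  exact ⟨max C 0, le_max_right _ _, fun x hx => (hC x hx).trans (le_max_left _ _)⟩

theorem UnitKernel.hasCompactSupport {E : Type*} [NormedAddCommGroup E] {k : 𝔼 → E}
    (hk : UnitKernel k) : HasCompactSupport k := by
  refine HasCompactSupport.intro (isCompact_closedBall (0 : 𝔼) 1) fun y hy => hk.zero y ?_
  simpa using hy

namespace UnitKernel

variable {k : EuclideanSpace ℝ (Fin n) → E₁} {g : EuclideanSpace ℝ (Fin n) → ℝ}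

theorem integrable (hk : UnitKernel k) : Integrable k :=
  hk.cont.integrable_of_hasCompactSupport hk.hasCompactSupport

theorem fderiv (hk : UnitKernel k) (hk1 : ContDiff ℝ 1 k) : UnitKernel (fderiv ℝ k) where
  cont := hk1.continuous_fderiv one_ne_zero
  zero y hy := by
    have : k =ᶠ[𝓝 y] fun _ => 0 := by
      filter_upwards [(isOpen_lt continuous_const continuous_norm).mem_nhds hy] with z hz
      exact hk.zero z hz
    rw [this.fderiv_eq]; simp

theorem norm_sub_smul_le {x y : 𝔼} {s R r : ℝ} (hx : ‖x‖ ≤ R) (hs : |s| ≤ r) (hy : ‖y‖ ≤ 1) :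
    ‖x - s • y‖ ≤ R + r := by
  refine (norm_sub_le _ _).trans (add_le_add hx ?_)
  rw [norm_smul, Real.norm_eq_abs]
  nlinarith [norm_nonneg y, abs_nonneg s]

theorem norm_integrand_le (hk : UnitKernel k) {C R r s : ℝ} {x : 𝔼} (hx : ‖x‖ ≤ R) (hs : |s| ≤ r)
    (hC : ∀ z, ‖z‖ ≤ R + r → |g z| ≤ C) (y : 𝔼) : ‖g (x - s • y) • k y‖ ≤ C * ‖k y‖ := by
  by_cases hy : 1 < ‖y‖
  · simp [hk.zero y hy]
  · rw [norm_smul, Real.norm_eq_abs]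
    exact mul_le_mul_of_nonneg_right (hC _ (norm_sub_smul_le hx hs (not_lt.1 hy))) (norm_nonneg _)

theorem stronglyMeasurable_uncurry (hk : UnitKernel k) (hg : Measurable g) (x : 𝔼) :
    StronglyMeasurable (Function.uncurry fun (s : ℝ) (y : 𝔼) => g (x - s • y) • k y) := by
  refine StronglyMeasurable.smul (f := fun p : ℝ × 𝔼 => g (x - p.1 • p.2))
    (g := fun p : ℝ × 𝔼 => k p.2) ?_ ?_
  · exact (hg.comp (by fun_prop)).stronglyMeasurable
  · have := hk.cont.stronglyMeasurable_of_hasCompactSupport hk.hasCompactSupport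
    exact this.comp_measurable measurable_snd

theorem aestronglyMeasurable_integrand (hk : UnitKernel k) (hg : Measurable g) (s : ℝ) (x : 𝔼) :
    AEStronglyMeasurable (fun y => g (x - s • y) • k y) volume := by
  have := (hk.stronglyMeasurable_uncurry hg x).comp_measurable
    (measurable_prodMk_left (x := s) (β := 𝔼))
  exact this.aestronglyMeasurable

theorem integrable_integrand (hk : UnitKernel k) (hg : LocBdd g) (s : ℝ) (x : 𝔼) :
    Integrable (fun y => g (x - s • y) • k y) := by
  obtain ⟨C, -, hC⟩ := hg.bdd_nonneg (‖x‖ + |s|)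
  exact (hk.integrable.norm.const_mul C).mono' (hk.aestronglyMeasurable_integrand hg.meas s x)
    (Eventually.of_forall fun y => hk.norm_integrand_le le_rfl le_rfl hC y)

theorem norm_avg_le (hk : UnitKernel k) {C R r s : ℝ} {x : 𝔼} (hx : ‖x‖ ≤ R) (hs : |s| ≤ r)
    (hC : ∀ z, ‖z‖ ≤ R + r → |g z| ≤ C) : ‖avg k g s x‖ ≤ C * ∫ y, ‖k y‖ := by
  rw [← integral_const_mul]
  exact norm_integral_le_of_norm_le (hk.integrable.norm.const_mul C)
    (Eventually.of_forall fun y => hk.norm_integrand_le hx hs hC y)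

theorem stronglyMeasurable_avg (hk : UnitKernel k) (hg : Measurable g) (x : 𝔼) :
    StronglyMeasurable fun s => avg k g s x :=
  (hk.stronglyMeasurable_uncurry hg x).integral_prod_right

theorem avg_eq_convolution {s : ℝ} (hs : s ≠ 0) (x : 𝔼) :
    avg k g s x = (convolution k (fun y => g (s • y))
      (ContinuousLinearMap.lsmul ℝ ℝ).flip volume) (s⁻¹ • x) := by
  simp [avg, convolution_def, smul_sub, smul_smul, hs]

theorem locallyIntegrable_comp_smul (hg : LocBdd g) (s : ℝ) :
    LocallyIntegrable (fun y => g (s • y)) := by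
  rw [locallyIntegrable_iff]
  intro K hK
  obtain ⟨r, hr⟩ := hK.isBounded.subset_closedBall 0
  obtain ⟨C, hC⟩ := hg.bdd (|s| * r)
  refine Measure.integrableOn_of_bounded (M := C) hK.measure_lt_top.ne
    (hg.meas.comp (measurable_const_smul s)).aestronglyMeasurable ?_
  filter_upwards [ae_restrict_mem hK.measurableSet] with y hy
  refine hC _ ?_
  rw [norm_smul, Real.norm_eq_abs]
  exact mul_le_mul_of_nonneg_left (by simpa using hr hy) (abs_nonneg s)

theorem continuous_avg (hk : UnitKernel k) (hg : LocBdd g) {s : ℝ} (hs : s ≠ 0) :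
    Continuous (avg k g s) := by
  have : avg k g s = fun x => (convolution k (fun y => g (s • y))
      (ContinuousLinearMap.lsmul ℝ ℝ).flip volume) (s⁻¹ • x) := funext (avg_eq_convolution hs)
  rw [this]
  exact (hk.hasCompactSupport.continuous_convolution_left _ hk.cont
    (locallyIntegrable_comp_smul hg s)).comp (continuous_const_smul _)

theorem hasFDerivAt_avg (hk : UnitKernel k) (hk1 : ContDiff ℝ 1 k) (hg : LocBdd g) {s : ℝ}
    (hs : s ≠ 0) (x : 𝔼) :
    HasFDerivAt (avg k g s) (s⁻¹ • avg (_root_.fderiv ℝ k) g s x) x := by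
  have : avg k g s = fun x => (convolution k (fun y => g (s • y))
      (ContinuousLinearMap.lsmul ℝ ℝ).flip volume) (s⁻¹ • x) := funext (avg_eq_convolution hs)
  rw [this]
  have h1 := hk.hasCompactSupport.hasFDerivAt_convolution_left
    (ContinuousLinearMap.lsmul ℝ ℝ).flip hk1 (locallyIntegrable_comp_smul hg s) (s⁻¹ • x)
  have h2 := h1.comp x ((s⁻¹ • ContinuousLinearMap.id ℝ 𝔼).hasFDerivAt)
  refine h2.congr_fderiv ?_
  rw [avg_eq_convolution hs]
  have : (ContinuousLinearMap.lsmul ℝ ℝ).flip.precompL 𝔼 =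
      (ContinuousLinearMap.lsmul ℝ ℝ (E := 𝔼 →L[ℝ] E₁)).flip := by
    ext; simp
  rw [this]
  ext; simp

end UnitKernel

end Averages

section RadialPotential

variable {n : ℕ}

local notation "𝔼" => EuclideanSpace ℝ (Fin n)

variable {E₁ : Type*} [NormedAddCommGroup E₁] [NormedSpace ℝ E₁]

/-- The superposition of the averages of `g` at all scales up to `r`. -/
noncomputable def radialPot {n : ℕ} {E₁ : Type*} [NormedAddCommGroup E₁] [NormedSpace ℝ E₁]
    (k : EuclideanSpace ℝ (Fin n) → E₁) (g : EuclideanSpace ℝ (Fin n) → ℝ) (r : ℝ)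
    (x : EuclideanSpace ℝ (Fin n)) : E₁ :=
  ∫ s in (0 : ℝ)..r, s • avg k g s x

namespace UnitKernel

variable {k : EuclideanSpace ℝ (Fin n) → E₁} {g : EuclideanSpace ℝ (Fin n) → ℝ}

theorem exists_norm_avg_le (hk : UnitKernel k) (hg : LocBdd g) (R r : ℝ) :
    ∃ C, 0 ≤ C ∧ ∀ x s, ‖x‖ ≤ R → |s| ≤ r → ‖avg k g s x‖ ≤ C := by
  obtain ⟨C, hC0, hC⟩ := hg.bdd_nonneg (R + r)
  exact ⟨C * ∫ y, ‖k y‖, mul_nonneg hC0 (integral_nonneg fun _ => norm_nonneg _),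
    fun x s hx hs => hk.norm_avg_le hx hs hC⟩

theorem intervalIntegrable_avg (hk : UnitKernel k) (hg : LocBdd g) (r : ℝ) (x : 𝔼) :
    IntervalIntegrable (fun s => avg k g s x) volume 0 r := by
  obtain ⟨C, -, hC⟩ := hk.exists_norm_avg_le hg ‖x‖ |r|
  refine (intervalIntegrable_const (c := C)).mono_fun'
    (hk.stronglyMeasurable_avg hg.meas x).aestronglyMeasurable ?_
  filter_upwards [ae_restrict_mem measurableSet_uIoc] with s hs
  refine hC x s le_rfl ?_
  simpa using Set.abs_sub_left_of_mem_uIcc (Set.uIoc_subset_uIcc hs)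

theorem intervalIntegrable_smul_avg (hk : UnitKernel k) (hg : LocBdd g) (r : ℝ) (x : 𝔼) :
    IntervalIntegrable (fun s => s • avg k g s x) volume 0 r :=
  (hk.intervalIntegrable_avg hg r x).continuousOn_smul continuousOn_id

theorem hasFDerivAt_radialPot (hk : UnitKernel k) (hk1 : ContDiff ℝ 1 k) (hg : LocBdd g) {r : ℝ}
    (hr : 0 ≤ r) (x : 𝔼) :
    HasFDerivAt (radialPot k g r) (∫ s in (0 : ℝ)..r, avg (_root_.fderiv ℝ k) g s x) x := by
  have hk' := hk.fderiv hk1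
  obtain ⟨C, -, hC⟩ := hk'.exists_norm_avg_le hg (‖x‖ + 1) r
  refine intervalIntegral.hasFDerivAt_integral_of_dominated_of_fderiv_le (bound := fun _ => C)
    (F := fun x s => s • avg k g s x) (F' := fun x s => avg (_root_.fderiv ℝ k) g s x)
    (ball_mem_nhds x one_pos) ?_ (hk.intervalIntegrable_smul_avg hg r x)
    (hk'.stronglyMeasurable_avg hg.meas x).aestronglyMeasurable ?_ intervalIntegrable_const ?_
  · exact Eventually.of_forall fun z =>
      (stronglyMeasurable_id.smul (hk.stronglyMeasurable_avg hg.meas z)).aestronglyMeasurable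
  · refine Eventually.of_forall fun s hs z hz => hC z s ?_ ?_
    · have h1 : ‖z - x‖ < 1 := by simpa [dist_eq_norm] using hz
      have h2 := norm_le_norm_add_norm_sub' z x
      linarith
    · rw [Set.uIoc_of_le hr] at hs
      rw [abs_of_pos hs.1]; exact hs.2
  · refine Eventually.of_forall fun s hs z hz => ?_
    rw [Set.uIoc_of_le hr] at hs
    refine ((hk.hasFDerivAt_avg hk1 hg hs.1.ne' z).const_smul s).congr_fderiv ?_
    rw [smul_smul, mul_inv_cancel₀ hs.1.ne', one_smul]

theorem continuous_integral_avg (hk : UnitKernel k) (hg : LocBdd g) {r : ℝ} (hr : 0 ≤ r) :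
    Continuous fun x => ∫ s in (0 : ℝ)..r, avg k g s x := by
  refine continuous_iff_continuousAt.2 fun x => ?_
  obtain ⟨C, -, hC⟩ := hk.exists_norm_avg_le hg (‖x‖ + 1) r
  refine intervalIntegral.continuousAt_of_dominated_interval (bound := fun _ => C)
    (Eventually.of_forall fun z => (hk.stronglyMeasurable_avg hg.meas z).aestronglyMeasurable)
    ?_ intervalIntegrable_const ?_
  · filter_upwards [ball_mem_nhds x one_pos] with z hz
    refine Eventually.of_forall fun s hs => hC z s ?_ ?_
    · have h1 : ‖z - x‖ < 1 := by simpa [dist_eq_norm] using hz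
      have h2 := norm_le_norm_add_norm_sub' z x
      linarith
    · rw [Set.uIoc_of_le hr] at hs
      rw [abs_of_pos hs.1]; exact hs.2
  · refine Eventually.of_forall fun s hs => ?_
    rw [Set.uIoc_of_le hr] at hs
    exact (hk.continuous_avg hg hs.1.ne').continuousAt

theorem contDiff_one_radialPot (hk : UnitKernel k) (hk1 : ContDiff ℝ 1 k) (hg : LocBdd g) {r : ℝ}
    (hr : 0 ≤ r) : ContDiff ℝ 1 (radialPot k g r) :=
  contDiff_one_iff_hasFDerivAt.2
    ⟨_, (hk.fderiv hk1).continuous_integral_avg hg hr, hk.hasFDerivAt_radialPot hk1 hg hr⟩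

theorem continuous_avg_scale (hk : UnitKernel k) (hg : Continuous g) (x : 𝔼) :
    Continuous fun s => avg k g s x := by
  refine continuous_iff_continuousAt.2 fun s => ?_
  obtain ⟨C, -, hC⟩ := hg.locBdd.bdd_nonneg (‖x‖ + (|s| + 1))
  refine continuousAt_of_dominated (bound := fun y => C * ‖k y‖)
    (Eventually.of_forall fun t => hk.aestronglyMeasurable_integrand hg.measurable t x) ?_
    (hk.integrable.norm.const_mul C) ?_
  · filter_upwards [ball_mem_nhds s one_pos] with t ht
    refine Eventually.of_forall fun y => hk.norm_integrand_le le_rfl ?_ hC y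
    have h1 : |t - s| < 1 := by simpa [Real.dist_eq] using ht
    have h2 := abs_sub_abs_le_abs_sub t s
    linarith
  · refine Eventually.of_forall fun y => Continuous.continuousAt ?_
    fun_prop

end UnitKernel

section Scalar

variable {k g : EuclideanSpace ℝ (Fin n) → ℝ}

theorem UnitKernel.fderiv_apply (hk : UnitKernel k) (hk1 : ContDiff ℝ 1 k) (e : 𝔼) :
    UnitKernel fun y => _root_.fderiv ℝ k y e where
  cont := (hk.fderiv hk1).cont.clm_apply continuous_const
  zero y hy := by simp [(hk.fderiv hk1).zero y hy]

theorem avg_fderiv_kernel (hk : UnitKernel k) (hk1 : ContDiff ℝ 1 k) (hg : ContDiff ℝ 1 g)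
    (s : ℝ) (x e : 𝔼) :
    avg (fun y => fderiv ℝ k y e) g s x = s * avg k (fun y => fderiv ℝ g y e) s x := by
  have hg' : Continuous fun y => fderiv ℝ g y e :=
    (hg.continuous_fderiv one_ne_zero).clm_apply continuous_const
  have hd (y : 𝔼) : HasFDerivAt (fun y => g (x - s • y))
      (-(s • fderiv ℝ g (x - s • y))) y := by
    have h1 := ((hg.differentiable one_ne_zero) (x - s • y)).hasFDerivAt.comp y
      (((hasFDerivAt_id y).const_smul s).const_sub x)
    refine h1.congr_fderiv ?_
    ext; simp
  have key := integral_mul_fderiv_eq_neg_fderiv_mul_of_integrable (μ := volume) (v := e)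
    (f := fun y => g (x - s • y)) (g := k) ?_ ?_ ?_ ?_ ?_
  · simp only [avg, smul_eq_mul]
    rw [key, ← integral_const_mul, ← integral_neg]
    congr 1; ext y
    rw [(hd y).fderiv]; simp; ring
  · have := (hk.integrable_integrand hg'.locBdd s x).const_mul (-s)
    refine this.congr (Eventually.of_forall fun y => ?_)
    simp only [(hd y).fderiv]; simp; ring
  · exact (hk.fderiv_apply hk1 e).integrable_integrand hg.continuous.locBdd s x
  · exact hk.integrable_integrand hg.continuous.locBdd s x
  · exact fun y _ => (hd y).differentiableAt
  · exact fun y _ => hk1.differentiable one_ne_zero y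

theorem contDiff_two_radialPot (hk : UnitKernel k) (hk1 : ContDiff ℝ 1 k) (hg : ContDiff ℝ 1 g)
    {r : ℝ} (hr : 0 ≤ r) : ContDiff ℝ 2 (radialPot k g r) := by
  have hgl := hg.continuous.locBdd
  have hd := hk.hasFDerivAt_radialPot hk1 hgl hr
  have : (2 : WithTop ℕ∞) = 1 + 1 := by norm_num
  rw [this, contDiff_succ_iff_fderiv]
  refine ⟨fun x => (hd x).differentiableAt, by simp, contDiff_clm_apply_iff.2 fun e => ?_⟩
  have hg' : Continuous fun y => fderiv ℝ g y e :=
    (hg.continuous_fderiv one_ne_zero).clm_apply continuous_const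
  convert hk.contDiff_one_radialPot hk1 hg'.locBdd hr using 1
  ext x
  rw [(hd x).fderiv]
  refine (ContinuousLinearMap.intervalIntegral_apply
    ((hk.fderiv hk1).intervalIntegrable_avg hgl r x) e).trans ?_
  unfold radialPot
  congr 1; ext s
  rw [smul_eq_mul, ← avg_fderiv_kernel hk hk1 hg]
  exact (ContinuousLinearMap.integral_apply ((hk.fderiv hk1).integrable_integrand hgl s x) e)

end Scalar

end RadialPotential

section Representation

variable {n : ℕ}

local notation "𝔼" => EuclideanSpace ℝ (Fin n)

/-- A radial bump function, supported in the unit ball. -/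
noncomputable def radialBump {n : ℕ} (y : EuclideanSpace ℝ (Fin n)) : ℝ :=
  expNegInvGlue (1 - ‖y‖ ^ 2)

/-- The kernel `k` such that the gradient of `radialBump` at `y` is `-k y • y`. -/
noncomputable def radialBumpSlope {n : ℕ} (y : EuclideanSpace ℝ (Fin n)) : ℝ :=
  2 * deriv expNegInvGlue (1 - ‖y‖ ^ 2)

theorem deriv_expNegInvGlue (x : ℝ) : deriv expNegInvGlue x = (x⁻¹) ^ 2 * expNegInvGlue x := by
  have := (expNegInvGlue.hasDerivAt_polynomial_eval_inv_mul 1 x).deriv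
  simpa using this

theorem contDiff_radialBump : ContDiff ℝ ∞ (radialBump : 𝔼 → ℝ) :=
  expNegInvGlue.contDiff.comp (contDiff_const.sub (contDiff_norm_sq ℝ))

theorem contDiff_radialBumpSlope : ContDiff ℝ ∞ (radialBumpSlope : 𝔼 → ℝ) := by
  have h : ContDiff ℝ ∞ (deriv expNegInvGlue) :=
    (contDiff_infty_iff_deriv.1 expNegInvGlue.contDiff).2
  exact contDiff_const.mul (h.comp (contDiff_const.sub (contDiff_norm_sq ℝ)))

theorem radialBump_nonneg (y : 𝔼) : 0 ≤ radialBump y := expNegInvGlue.nonneg _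

theorem radialBumpSlope_nonneg (y : 𝔼) : 0 ≤ radialBumpSlope y := by
  rw [radialBumpSlope, deriv_expNegInvGlue]
  have := expNegInvGlue.nonneg (1 - ‖y‖ ^ 2)
  positivity

theorem radialBump_pos {y : 𝔼} (hy : ‖y‖ < 1) : 0 < radialBump y :=
  expNegInvGlue.pos_of_pos (by nlinarith [norm_nonneg y])

theorem radialBumpSlope_pos {y : 𝔼} (hy : ‖y‖ < 1) : 0 < radialBumpSlope y := by
  rw [radialBumpSlope, deriv_expNegInvGlue]
  have h : 0 < 1 - ‖y‖ ^ 2 := by nlinarith [norm_nonneg y]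
  have := expNegInvGlue.pos_of_pos h
  positivity

theorem unitKernel_radialBump : UnitKernel (radialBump : 𝔼 → ℝ) where
  cont := contDiff_radialBump.continuous
  zero y hy := expNegInvGlue.zero_of_nonpos (by nlinarith)

theorem unitKernel_radialBumpSlope : UnitKernel (radialBumpSlope : 𝔼 → ℝ) where
  cont := contDiff_radialBumpSlope.continuous
  zero y hy := by
    rw [radialBumpSlope, deriv_expNegInvGlue, expNegInvGlue.zero_of_nonpos (by nlinarith)]
    simp

theorem UnitKernel.integral_pos {k : 𝔼 → ℝ} (hk : UnitKernel k) (h0 : ∀ y, 0 ≤ k y)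
    (h : 0 < k 0) : 0 < ∫ y, k y :=
  hk.cont.integral_pos_of_hasCompactSupport_nonneg_nonzero hk.hasCompactSupport h0 h.ne'

theorem integral_radialBump_pos : 0 < ∫ y : 𝔼, radialBump y :=
  unitKernel_radialBump.integral_pos radialBump_nonneg (radialBump_pos (by simp))

theorem integral_radialBumpSlope_pos : 0 < ∫ y : 𝔼, radialBumpSlope y :=
  unitKernel_radialBumpSlope.integral_pos radialBumpSlope_nonneg (radialBumpSlope_pos (by simp))

theorem fderiv_radialBump (y e : 𝔼) :
    fderiv ℝ radialBump y e = -(radialBumpSlope y * inner ℝ y e) := by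
  have h1 : HasFDerivAt (fun y : 𝔼 => 1 - ‖y‖ ^ 2) (-(2 • innerSL ℝ y)) y :=
    (hasStrictFDerivAt_norm_sq y).hasFDerivAt.const_sub 1
  have h2 : HasDerivAt expNegInvGlue (deriv expNegInvGlue (1 - ‖y‖ ^ 2)) (1 - ‖y‖ ^ 2) :=
    ((expNegInvGlue.contDiff (n := 1)).differentiable one_ne_zero _).hasDerivAt
  have h3 : HasFDerivAt (radialBump : 𝔼 → ℝ) _ y := h2.comp_hasFDerivAt y h1
  rw [h3.fderiv, radialBumpSlope]
  simp
  ring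

theorem fderiv_apply_eq_sum (v : 𝔼 → ℝ) (z y : 𝔼) :
    fderiv ℝ v z y = ∑ i, y i * fderiv ℝ v z (EuclideanSpace.single i 1) := by
  have : y = ∑ i, y i • EuclideanSpace.single i (1 : ℝ) := by
    have := (EuclideanSpace.basisFun (Fin n) ℝ).sum_repr y
    simpa using this.symm
  conv_lhs => rw [this]
  simp

theorem hasDerivAt_avg_radialBumpSlope {v : 𝔼 → ℝ} (hv : ContDiff ℝ 2 v) (s : ℝ) (x : 𝔼) :
    HasDerivAt (fun s => avg radialBumpSlope v s x) (s * avg radialBump (lap v) s x) s := by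
  have hk := unitKernel_radialBumpSlope (n := n)
  have hσ := unitKernel_radialBump (n := n)
  have hσ1 : ContDiff ℝ 1 (radialBump : 𝔼 → ℝ) := contDiff_radialBump.of_le (by norm_cast)
  let e (i : Fin n) : 𝔼 := EuclideanSpace.single i 1
  have hv1 (i) : ContDiff ℝ 1 (fun y => fderiv ℝ v y (e i)) := hv.fderiv_apply_const (e i)
  have hv2 (i) : Continuous (fun y => fderiv ℝ (fun z => fderiv ℝ v z (e i)) y (e i)) :=
    ((hv1 i).continuous_fderiv one_ne_zero).clm_apply continuous_const
  have hF' (t : ℝ) (y : 𝔼) : -(fderiv ℝ v (x - t • y) y) * radialBumpSlope y =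
      ∑ i, fderiv ℝ v (x - t • y) (e i) • fderiv ℝ radialBump y (e i) := by
    rw [fderiv_apply_eq_sum, neg_mul, Finset.sum_mul, ← Finset.sum_neg_distrib]
    refine Finset.sum_congr rfl fun i _ => ?_
    rw [fderiv_radialBump]
    simp [e, EuclideanSpace.inner_single_right]
    ring
  have hint (i) (t : ℝ) := (hσ.fderiv_apply hσ1 (e i)).integrable_integrand
    (hv1 i).continuous.locBdd t x
  have hsum : s * avg radialBump (lap v) s x =
      ∫ y, -(fderiv ℝ v (x - s • y) y) * radialBumpSlope y := by
    simp_rw [hF']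
    rw [integral_finsetSum _ fun i _ => hint i s]
    have h1 : avg radialBump (lap v) s x =
        ∑ i, avg radialBump (fun y => fderiv ℝ (fun z => fderiv ℝ v z (e i)) y (e i)) s x := by
      unfold avg
      rw [← integral_finsetSum _ fun i _ => hσ.integrable_integrand (hv2 i).locBdd s x]
      congr 1; ext y
      rw [lap, Finset.sum_smul]
    rw [h1, Finset.mul_sum]
    refine Finset.sum_congr rfl fun i _ => ?_
    rw [← avg_fderiv_kernel hσ hσ1 (hv1 i)]
    rfl
  rw [hsum]
  have hv' : Continuous fun z => ‖fderiv ℝ v z‖ :=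
    (hv.continuous_fderiv two_ne_zero).norm
  obtain ⟨C, hC0, hC⟩ := hv'.locBdd.bdd_nonneg (‖x‖ + (|s| + 1))
  refine (hasDerivAt_integral_of_dominated_loc_of_deriv_le
    (bound := fun y => C * ‖radialBumpSlope y‖)
    (F' := fun t y => -(fderiv ℝ v (x - t • y) y) * radialBumpSlope y)
    (ball_mem_nhds s one_pos)
    (Eventually.of_forall fun t => hk.aestronglyMeasurable_integrand hv.continuous.measurable t x)
    (hk.integrable_integrand hv.continuous.locBdd s x) ?_ ?_
    (hk.integrable.norm.const_mul C) ?_).2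
  · simp_rw [hF']
    exact (integrable_finsetSum _ fun i _ => hint i s).aestronglyMeasurable
  · refine Eventually.of_forall fun y t ht => ?_
    have ht' : |t| ≤ |s| + 1 := by
      have h1 : |t - s| < 1 := by simpa [Real.dist_eq] using ht
      have h2 := abs_sub_abs_le_abs_sub t s
      linarith
    by_cases hy : 1 < ‖y‖
    · simp [hk.zero y hy]
    · rw [norm_mul, norm_neg]
      gcongr
      have h1 := hC _ (UnitKernel.norm_sub_smul_le le_rfl ht' (not_lt.1 hy))
      rw [abs_norm] at h1
      refine (ContinuousLinearMap.le_opNorm _ _).trans ?_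
      nlinarith [norm_nonneg y, norm_nonneg (fderiv ℝ v (x - t • y))]
  · refine Eventually.of_forall fun y t ht => ?_
    have h1 : HasDerivAt (fun t : ℝ => x - t • y) (-y) t := by
      simpa using ((hasDerivAt_id t).smul_const y).const_sub x
    have h2 := ((hv.differentiable two_ne_zero) (x - t • y)).hasFDerivAt.comp_hasDerivAt t h1
    simpa using h2.mul_const (radialBumpSlope y)

theorem avg_zero_scale (k g : 𝔼 → ℝ) (x : 𝔼) : avg k g 0 x = (∫ y, k y) * g x := by
  simp only [avg, zero_smul, sub_zero, smul_eq_mul]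
  rw [integral_const_mul, mul_comm]

theorem avg_sub_eq_radialPot_lap {v : 𝔼 → ℝ} (hv : ContDiff ℝ 2 v) (r : ℝ) (x : 𝔼) :
    avg radialBumpSlope v r x - (∫ y : 𝔼, radialBumpSlope y) * v x =
      radialPot radialBump (lap v) r x := by
  rw [← avg_zero_scale, radialPot]
  refine (intervalIntegral.integral_eq_sub_of_hasDerivAt
    (fun s _ => hasDerivAt_avg_radialBumpSlope hv s x) ?_).symm
  exact unitKernel_radialBump.intervalIntegrable_smul_avg (continuous_lap hv).locBdd r x

end Representation

section Limits

variable {n : ℕ}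

local notation "𝔼" => EuclideanSpace ℝ (Fin n)

variable {k : EuclideanSpace ℝ (Fin n) → ℝ} {w : ℕ → EuclideanSpace ℝ (Fin n) → ℝ}
  {v : EuclideanSpace ℝ (Fin n) → ℝ}

theorem LocBdd.of_tendsto (hw : ∀ j, Measurable (w j))
    (hb : ∀ R, ∃ C, ∀ j x, ‖x‖ ≤ R → |w j x| ≤ C)
    (hlim : ∀ x, Tendsto (fun j => w j x) atTop (𝓝 (v x))) : LocBdd v where
  meas := measurable_of_tendsto_metrizable hw (tendsto_pi_nhds.2 hlim)
  bdd R := by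
    obtain ⟨C, hC⟩ := hb R
    exact ⟨C, fun x hx => le_of_tendsto' (hlim x).abs fun j => hC j x hx⟩

namespace UnitKernel

theorem tendsto_avg (hk : UnitKernel k) (hw : ∀ j, Measurable (w j))
    (hb : ∀ R, ∃ C, ∀ j x, ‖x‖ ≤ R → |w j x| ≤ C)
    (hlim : ∀ x, Tendsto (fun j => w j x) atTop (𝓝 (v x))) (s : ℝ) (x : 𝔼) :
    Tendsto (fun j => avg k (w j) s x) atTop (𝓝 (avg k v s x)) := by
  obtain ⟨C, hC⟩ := hb (‖x‖ + |s|)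
  refine tendsto_integral_of_dominated_convergence (fun y => C * ‖k y‖)
    (fun j => hk.aestronglyMeasurable_integrand (hw j) s x) (hk.integrable.norm.const_mul C)
    (fun j => Eventually.of_forall fun y => hk.norm_integrand_le le_rfl le_rfl (hC j) y)
    (Eventually.of_forall fun y => (hlim _).smul_const _)

theorem tendsto_radialPot (hk : UnitKernel k) (hw : ∀ j, Measurable (w j))
    (hb : ∀ R, ∃ C, ∀ j x, ‖x‖ ≤ R → |w j x| ≤ C)
    (hlim : ∀ x, Tendsto (fun j => w j x) atTop (𝓝 (v x))) {r : ℝ} (hr : 0 ≤ r) (x : 𝔼) :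
    Tendsto (fun j => radialPot k (w j) r x) atTop (𝓝 (radialPot k v r x)) := by
  obtain ⟨C, hC⟩ := hb (‖x‖ + r)
  refine intervalIntegral.tendsto_integral_filter_of_dominated_convergence
    (fun _ => r * (C * ∫ y, ‖k y‖)) (Eventually.of_forall fun j =>
      (stronglyMeasurable_id.smul (hk.stronglyMeasurable_avg (hw j) x)).aestronglyMeasurable)
    (Eventually.of_forall fun j => Eventually.of_forall fun s hs => ?_) intervalIntegrable_const
    (Eventually.of_forall fun s _ => (hk.tendsto_avg hw hb hlim s x).const_smul s)
  rw [Set.uIoc_of_le hr] at hs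
  have hs' : |s| ≤ r := by rw [abs_of_pos hs.1]; exact hs.2
  rw [norm_smul, Real.norm_eq_abs]
  exact mul_le_mul hs' (hk.norm_avg_le le_rfl hs' (hC j)) (norm_nonneg _) hr

end UnitKernel

theorem avg_sub_eq_radialPot_of_tendsto {g : 𝔼 → ℝ} (hw : ∀ j, ContDiff ℝ 2 (w j))
    (hb : ∀ R, ∃ C, ∀ j x, ‖x‖ ≤ R → |w j x| ≤ C)
    (hlapb : ∀ R, ∃ C, ∀ j x, ‖x‖ ≤ R → |lap (w j) x| ≤ C)
    (hlim : ∀ x, Tendsto (fun j => w j x) atTop (𝓝 (v x)))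
    (hlap : ∀ x, Tendsto (fun j => lap (w j) x) atTop (𝓝 (g x))) {r : ℝ} (hr : 0 ≤ r) (x : 𝔼) :
    avg radialBumpSlope v r x - (∫ y : 𝔼, radialBumpSlope y) * v x = radialPot radialBump g r x := by
  have h1 := (unitKernel_radialBumpSlope.tendsto_avg (fun j => (hw j).continuous.measurable)
    hb hlim r x).sub ((hlim x).const_mul (∫ y : 𝔼, radialBumpSlope y))
  have h2 := unitKernel_radialBump.tendsto_radialPot
    (fun j => (continuous_lap (hw j)).measurable) hlapb hlap hr x
  refine tendsto_nhds_unique h1 (h2.congr fun j => ?_)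
  exact (avg_sub_eq_radialPot_lap (hw j) r x).symm

/-- A continuous function whose radial potentials all vanish is zero. -/
theorem eq_zero_of_radialPot_eq_zero {h : 𝔼 → ℝ} (hh : Continuous h) (x : 𝔼)
    (h0 : ∀ r, 0 ≤ r → radialPot radialBump h r x = 0) : h x = 0 := by
  have hc : Continuous fun s => avg radialBump h s x :=
    unitKernel_radialBump.continuous_avg_scale hh x
  have hz : ∀ s, 0 < s → avg radialBump h s x = 0 := by
    intro s hs
    have hd : HasDerivAt (fun r => radialPot radialBump h r x) (s • avg radialBump h s x) s :=
      (continuous_id.smul hc).integral_hasStrictDerivAt 0 s |>.hasDerivAt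
    have h1 : (fun r => radialPot radialBump h r x) =ᶠ[𝓝 s] fun _ => 0 := by
      filter_upwards [lt_mem_nhds hs] with r hr using h0 r hr.le
    have h2 := hd.unique ((hasDerivAt_const s (0 : ℝ)).congr_of_eventuallyEq h1)
    simpa [hs.ne'] using h2
  have h1 : avg radialBump h 0 x = 0 := by
    have h2 : Tendsto (fun s => avg radialBump h s x) (𝓝[>] 0) (𝓝 (avg radialBump h 0 x)) :=
      hc.continuousAt.tendsto.mono_left nhdsWithin_le_nhds
    refine tendsto_nhds_unique h2 (tendsto_const_nhds.congr' ?_)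
    filter_upwards [self_mem_nhdsWithin] with s hs using (hz s hs).symm
  rw [avg_zero_scale] at h1
  simpa [integral_radialBump_pos.ne'] using h1

theorem radialPot_sub {g h : 𝔼 → ℝ} (hg : LocBdd g) (hh : LocBdd h) (r : ℝ) (x : 𝔼) :
    radialPot radialBump (fun y => g y - h y) r x =
      radialPot radialBump g r x - radialPot radialBump h r x := by
  have hk := unitKernel_radialBump (n := n)
  unfold radialPot
  rw [← intervalIntegral.integral_sub (hk.intervalIntegrable_smul_avg hg r x)
    (hk.intervalIntegrable_smul_avg hh r x)]
  congr 1; ext s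
  rw [← smul_sub]
  unfold avg
  rw [← integral_sub (hk.integrable_integrand hg s x) (hk.integrable_integrand hh s x)]
  simp only [sub_smul]

/-- Interior regularity: a pointwise limit of solutions of the Poisson equation, whose right-hand
sides converge pointwise to `-V (1 - v)`, is a classical solution. -/
theorem contDiff_two_and_lap_eq_of_tendsto {V : 𝔼 → ℝ} (hV : ContDiff ℝ 1 V)
    (hw : ∀ j, ContDiff ℝ 2 (w j))
    (hb : ∀ R, ∃ C, ∀ j x, ‖x‖ ≤ R → |w j x| ≤ C)
    (hlapb : ∀ R, ∃ C, ∀ j x, ‖x‖ ≤ R → |lap (w j) x| ≤ C)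
    (hlim : ∀ x, Tendsto (fun j => w j x) atTop (𝓝 (v x)))
    (hlap : ∀ x, Tendsto (fun j => lap (w j) x) atTop (𝓝 (-(V x * (1 - v x))))) :
    ContDiff ℝ 2 v ∧ ∀ x, lap v x = -(V x * (1 - v x)) := by
  have hvl : LocBdd v := .of_tendsto (fun j => (hw j).continuous.measurable) hb hlim
  have hgl : LocBdd fun x => -(V x * (1 - v x)) :=
    .of_tendsto (fun j => (continuous_lap (hw j)).measurable) hlapb hlap
  have hid (r : ℝ) (hr : 0 ≤ r) (x) := avg_sub_eq_radialPot_of_tendsto hw hb hlapb hlim hlap hr x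
  have hM := integral_radialBumpSlope_pos (n := n)
  have hσ1 : ContDiff ℝ 1 (radialBump : 𝔼 → ℝ) := contDiff_radialBump.of_le (by norm_cast)
  have hveq : v = fun x => (∫ y : 𝔼, radialBumpSlope y)⁻¹ *
      (avg radialBumpSlope v 1 x - radialPot radialBump (fun x => -(V x * (1 - v x))) 1 x) := by
    ext x
    rw [← hid 1 zero_le_one x]
    field_simp
    ring
  have hA : ContDiff ℝ 2 (avg radialBumpSlope v 1) := by
    have h1 : avg radialBumpSlope v 1 = convolution radialBumpSlope v
        (ContinuousLinearMap.lsmul ℝ ℝ).flip volume := by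
      ext x
      simpa using UnitKernel.avg_eq_convolution (k := radialBumpSlope) (g := v) one_ne_zero x
    rw [h1]
    exact unitKernel_radialBumpSlope.hasCompactSupport.contDiff_convolution_left _
      (contDiff_radialBumpSlope.of_le (by norm_cast))
      (by simpa using UnitKernel.locallyIntegrable_comp_smul hvl 1)
  have hv1 : ContDiff ℝ 1 v := by
    rw [hveq]
    exact contDiff_const.mul ((hA.of_le one_le_two).sub
      (unitKernel_radialBump.contDiff_one_radialPot hσ1 hgl zero_le_one))
  have hg1 : ContDiff ℝ 1 fun x => -(V x * (1 - v x)) := (hV.mul (contDiff_const.sub hv1)).neg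
  have hv2 : ContDiff ℝ 2 v := by
    rw [hveq]
    exact contDiff_const.mul (hA.sub
      (contDiff_two_radialPot unitKernel_radialBump hσ1 hg1 zero_le_one))
  refine ⟨hv2, fun x => sub_eq_zero.1 ?_⟩
  have hlc := continuous_lap hv2
  refine eq_zero_of_radialPot_eq_zero (h := fun x => lap v x - -(V x * (1 - v x)))
    (hlc.sub hg1.continuous) x fun r hr => ?_
  rw [radialPot_sub hlc.locBdd hgl, ← hid r hr x, ← avg_sub_eq_radialPot_lap hv2, sub_self]

end Limits

section CompactlySupportedPotential

variable {n : ℕ}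

local notation "𝔼" => EuclideanSpace ℝ (Fin n)

theorem exists_schwartz_iterate {V : 𝔼 → ℝ} (hV : ContDiff ℝ ∞ V) (hVc : HasCompactSupport V)
    {a : ℝ} (ha : 0 < a) (f : 𝓢(𝔼, ℝ)) :
    ∃ w : 𝓢(𝔼, ℝ), ∀ x, a * w x - lap w x = (a - V x) * f x + V x := by
  have h1 : HasCompactSupport fun x => V x * (1 - f x) := hVc.mul_right
  have h2 : ContDiff ℝ ∞ fun x => V x * (1 - f x) := hV.mul (contDiff_const.sub (f.smooth _))
  obtain ⟨w, hw⟩ := exists_schwartz_resolvent ha (a • f + h1.toSchwartzMap h2)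
  refine ⟨w, fun x => (hw x).trans ?_⟩
  simp
  ring

theorem SchwartzMap.contDiff_two (f : 𝓢(𝔼, ℝ)) : ContDiff ℝ 2 f := f.smooth 2

/-- The minimal solution of `-lap v + V v = V` for a compactly supported potential `V`: it lies
below every supersolution that vanishes at infinity. -/
theorem exists_minimal_solution_of_hasCompactSupport {V : 𝔼 → ℝ} (hV : ContDiff ℝ ∞ V)
    (hVc : HasCompactSupport V) (hV0 : ∀ x, 0 ≤ V x) :
    ∃ v : 𝔼 → ℝ, ContDiff ℝ 2 v ∧ (∀ x, 0 ≤ v x) ∧ (∀ x, v x ≤ 1) ∧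
      (∀ x, lap v x = -(V x * (1 - v x))) ∧
      ∀ U : 𝔼 → ℝ, ContDiff ℝ 2 U → (∀ x, 0 ≤ U x) → Tendsto U (cocompact 𝔼) (𝓝 0) →
        (∀ x, lap U x ≤ -(V x * (1 - U x))) → ∀ x, v x ≤ U x := by
  obtain ⟨C, hC⟩ := hVc.exists_bound_of_continuous hV.continuous
  set a := |C| + 1 with ha_def
  have ha : 0 < a := by positivity
  have hVa (x) : V x ≤ a := by
    have h1 := hC x
    rw [Real.norm_eq_abs] at h1
    linarith [le_abs_self (V x), le_abs_self C]
  choose T hT using exists_schwartz_iterate hV hVc ha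
  let w (j : ℕ) : 𝓢(𝔼, ℝ) := T^[j] 0
  have hw0 (x) : w 0 x = 0 := rfl
  have hw (j x) : a * w (j + 1) x - lap (w (j + 1)) x = (a - V x) * w j x + V x := by
    simp only [w, Function.iterate_succ_apply']
    exact hT _ x
  have hlim (j) : Tendsto (w j) (cocompact 𝔼) (𝓝 0) := (w j).tendsto_cocompact
  have hnonneg (j) : ∀ x, 0 ≤ w j x := by
    induction j with
    | zero => exact fun x => (hw0 x).ge
    | succ j ih =>
      refine nonneg_of_sub_lap_nonneg (w (j + 1)).contDiff_two ha le_rfl (hlim _) fun x => ?_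
      rw [hw]
      have := mul_nonneg (sub_nonneg.2 (hVa x)) (ih x)
      linarith [hV0 x]
  have hle_one (j) : ∀ x, w j x ≤ 1 := by
    induction j with
    | zero => exact fun x => by rw [hw0]; exact zero_le_one
    | succ j ih =>
      refine fun x => sub_nonneg.1 (nonneg_of_sub_lap_nonneg (h := fun x => 1 - w (j + 1) x)
        (contDiff_const.sub (w (j + 1)).contDiff_two) ha (zero_le_one) ?_ (fun x => ?_) x)
      · simpa using (hlim (j + 1)).const_sub 1
      · rw [lap_sub contDiff_const (w (j + 1)).contDiff_two, lap_const]
        have := mul_nonneg (sub_nonneg.2 (hVa x)) (sub_nonneg.2 (ih x))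
        linarith [hw j x]
  have hmono (j) : ∀ x, w j x ≤ w (j + 1) x := by
    induction j with
    | zero => exact fun x => by rw [hw0]; exact hnonneg 1 x
    | succ j ih =>
      refine fun x => sub_nonneg.1 (nonneg_of_sub_lap_nonneg
        (h := fun x => w (j + 1 + 1) x - w (j + 1) x)
        ((w (j + 1 + 1)).contDiff_two.sub (w (j + 1)).contDiff_two) ha le_rfl ?_ (fun x => ?_) x)
      · simpa using (hlim (j + 1 + 1)).sub (hlim (j + 1))
      · rw [lap_sub (w (j + 1 + 1)).contDiff_two (w (j + 1)).contDiff_two]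
        have := mul_nonneg (sub_nonneg.2 (hVa x)) (sub_nonneg.2 (ih x))
        linarith [hw j x, hw (j + 1) x]
  have hle_super (U : 𝔼 → ℝ) (hU : ContDiff ℝ 2 U) (hU0 : ∀ x, 0 ≤ U x)
      (hUlim : Tendsto U (cocompact 𝔼) (𝓝 0)) (hUlap : ∀ x, lap U x ≤ -(V x * (1 - U x))) (j) :
      ∀ x, w j x ≤ U x := by
    induction j with
    | zero => exact fun x => by rw [hw0]; exact hU0 x
    | succ j ih =>
      refine fun x => sub_nonneg.1 (nonneg_of_sub_lap_nonneg (h := fun x => U x - w (j + 1) x)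
        (hU.sub (w (j + 1)).contDiff_two) ha le_rfl ?_ (fun x => ?_) x)
      · simpa using hUlim.sub (hlim (j + 1))
      · rw [lap_sub hU (w (j + 1)).contDiff_two]
        have := mul_nonneg (sub_nonneg.2 (hVa x)) (sub_nonneg.2 (ih x))
        linarith [hw j x, hUlap x]
  have hconv (x) : ∃ l, Tendsto (fun j => w j x) atTop (𝓝 l) :=
    ⟨_, tendsto_atTop_ciSup (monotone_nat_of_le_succ fun j => hmono j x)
      ⟨1, by rintro _ ⟨j, rfl⟩; exact hle_one j x⟩⟩
  choose v hv using hconv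
  have hv' (x) : Tendsto (fun j => w (j + 1) x) atTop (𝓝 (v x)) :=
    (tendsto_add_atTop_iff_nat 1).2 (hv x)
  have hlap (j x) : lap (w (j + 1)) x = a * w (j + 1) x - ((a - V x) * w j x + V x) := by
    linarith [hw j x]
  obtain ⟨hv2, hveq⟩ := contDiff_two_and_lap_eq_of_tendsto (v := v) (w := fun j => w (j + 1))
    (hV.of_le (by norm_cast)) (fun j => (w (j + 1)).contDiff_two)
    (fun R => ⟨1, fun j x _ => abs_le.2 ⟨by linarith [hnonneg (j + 1) x], hle_one (j + 1) x⟩⟩)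
    (fun R => ⟨a, fun j x _ => by
      rw [hlap, abs_le]
      have h1 := mul_nonneg (sub_nonneg.2 (hVa x)) (hnonneg j x)
      have h2 := mul_nonneg (sub_nonneg.2 (hVa x)) (sub_nonneg.2 (hle_one j x))
      have h3 := mul_nonneg ha.le (hnonneg (j + 1) x)
      have h4 := mul_nonneg ha.le (sub_nonneg.2 (hle_one (j + 1) x))
      constructor <;> linarith [hV0 x]⟩) hv' fun x => by
      simp_rw [hlap]
      convert ((hv' x).const_mul a).sub (((hv x).const_mul (a - V x)).add_const (V x)) using 2
      ring
  exact ⟨v, hv2, fun x => ge_of_tendsto' (hv x) fun j => hnonneg j x,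
    fun x => le_of_tendsto' (hv x) fun j => hle_one j x, hveq,
    fun U hU hU0 hUlim hUlap x =>
      le_of_tendsto' (hv x) fun j => hle_super U hU hU0 hUlim hUlap j x⟩

end CompactlySupportedPotential

section EntireSolution

variable {n : ℕ}

local notation "𝔼" => EuclideanSpace ℝ (Fin n)

/-- A smooth cutoff, equal to `1` where `‖x‖ ^ 2 ≤ k` and to `0` where `k + 1 ≤ ‖x‖ ^ 2`. -/
noncomputable def cutoff {n : ℕ} (k : ℕ) (x : EuclideanSpace ℝ (Fin n)) : ℝ :=
  Real.smoothTransition (k + 1 - ‖x‖ ^ 2)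

theorem contDiff_cutoff (k : ℕ) : ContDiff ℝ ∞ (cutoff k : 𝔼 → ℝ) :=
  Real.smoothTransition.contDiff.comp (contDiff_const.sub (contDiff_norm_sq ℝ))

theorem cutoff_nonneg (k : ℕ) (x : 𝔼) : 0 ≤ cutoff k x := Real.smoothTransition.nonneg _

theorem cutoff_le_one (k : ℕ) (x : 𝔼) : cutoff k x ≤ 1 := Real.smoothTransition.le_one _

theorem cutoff_le_succ (k : ℕ) (x : 𝔼) : cutoff k x ≤ cutoff (k + 1) x :=
  Real.smoothTransition.monotone (by push_cast; linarith)

theorem hasCompactSupport_cutoff (k : ℕ) : HasCompactSupport (cutoff k : 𝔼 → ℝ) := by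
  refine HasCompactSupport.intro (isCompact_closedBall (0 : 𝔼) (k + 1)) fun x hx => ?_
  have h1 : (k : ℝ) + 1 < ‖x‖ := by simpa using hx
  have h2 : (0 : ℝ) ≤ k := k.cast_nonneg
  exact Real.smoothTransition.zero_of_nonpos (by nlinarith)

theorem tendsto_cutoff (x : 𝔼) : Tendsto (fun k => cutoff k x) atTop (𝓝 1) := by
  obtain ⟨N, hN⟩ := exists_nat_ge (‖x‖ ^ 2)
  refine tendsto_const_nhds.congr' ?_
  filter_upwards [eventually_ge_atTop N] with k hk
  refine (Real.smoothTransition.one_of_one_le ?_).symm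
  have : (N : ℝ) ≤ k := by exact_mod_cast hk
  linarith

/-- The strong maximum principle for nonnegative superharmonic functions. -/
theorem eq_zero_of_lap_nonpos {v : 𝔼 → ℝ} (hv : ContDiff ℝ 2 v) (hv0 : ∀ x, 0 ≤ v x)
    (hlap : ∀ x, lap v x ≤ 0) {x₀ : 𝔼} (hx₀ : v x₀ = 0) (x : 𝔼) : v x = 0 := by
  by_contra hx
  have hk := unitKernel_radialBumpSlope (n := n)
  set r := ‖x₀ - x‖ + 1 with hr_def
  have hr : 0 < r := by positivity
  have hid := avg_sub_eq_radialPot_lap hv r x₀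
  rw [hx₀, mul_zero, sub_zero] at hid
  have h1 : radialPot radialBump (lap v) r x₀ ≤ 0 := by
    unfold radialPot
    rw [← neg_nonneg, ← intervalIntegral.integral_neg]
    refine intervalIntegral.integral_nonneg hr.le fun s hs => ?_
    rw [neg_nonneg, smul_eq_mul]
    refine mul_nonpos_of_nonneg_of_nonpos hs.1 (integral_nonpos fun y => ?_)
    exact mul_nonpos_of_nonpos_of_nonneg (hlap _) (radialBump_nonneg y)
  have h2 : 0 < avg radialBumpSlope v r x₀ := by
    unfold avg
    have hkey : UnitKernel fun y => v (x₀ - r • y) • radialBumpSlope y :=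
      { cont := (hv.continuous.comp (by fun_prop)).smul hk.cont
        zero := fun y hy => by simp [hk.zero y hy] }
    refine hkey.cont.integral_pos_of_hasCompactSupport_nonneg_nonzero
      hkey.hasCompactSupport (fun y => mul_nonneg (hv0 _) (radialBumpSlope_nonneg y))
      (x := r⁻¹ • (x₀ - x)) ?_
    have h3 : ‖r⁻¹ • (x₀ - x)‖ < 1 := by
      rw [norm_smul, norm_inv, Real.norm_of_nonneg hr.le, inv_mul_lt_one₀ hr]
      linarith
    rw [smul_smul, mul_inv_cancel₀ hr.ne', one_smul, sub_sub_cancel]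
    exact mul_ne_zero hx (radialBumpSlope_pos h3).ne'
  linarith

theorem exists_solution_of_poisson {V U : 𝔼 → ℝ} (hV : ContDiff ℝ ∞ V) (hV0 : ∀ x, 0 ≤ V x)
    (hVne : ∃ x, V x ≠ 0) (hU : ContDiff ℝ 2 U) (hU0 : ∀ x, 0 ≤ U x)
    (hUlap : ∀ x, lap U x = -V x) (hUlim : Tendsto U (cocompact 𝔼) (𝓝 0)) :
    ∃ v : 𝔼 → ℝ, ContDiff ℝ 2 v ∧ (∀ x, 0 < v x ∧ v x ≤ U x) ∧
      (∀ x, lap v x = -(V x * (1 - v x))) ∧ Tendsto v (cocompact 𝔼) (𝓝 0) := by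
  have hcut (k : ℕ) := exists_minimal_solution_of_hasCompactSupport ((contDiff_cutoff k).mul hV)
    (hasCompactSupport_cutoff k).mul_right (fun x => mul_nonneg (cutoff_nonneg k x) (hV0 x))
  choose w hw hw0 hw1 hwlap hwmin using hcut
  have hcut0 (k : ℕ) (x : 𝔼) : 0 ≤ cutoff k x * V x := mul_nonneg (cutoff_nonneg k x) (hV0 x)
  have hcutV (k : ℕ) (x : 𝔼) : cutoff k x * V x ≤ V x :=
    mul_le_of_le_one_left (hV0 x) (cutoff_le_one k x)
  have hwU (k : ℕ) : ∀ x, w k x ≤ U x := hwmin k U hU hU0 hUlim fun x => by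
    rw [hUlap]
    have := mul_nonneg (hcut0 k x) (hU0 x)
    linarith [hcutV k x]
  have hwlim (k : ℕ) : Tendsto (w k) (cocompact 𝔼) (𝓝 0) :=
    tendsto_of_tendsto_of_tendsto_of_le_of_le tendsto_const_nhds hUlim (hw0 k) (hwU k)
  have hmono (k : ℕ) : ∀ x, w k x ≤ w (k + 1) x :=
    hwmin k (w (k + 1)) (hw _) (hw0 _) (hwlim _) fun x => by
      rw [hwlap, neg_le_neg_iff]
      exact mul_le_mul_of_nonneg_right (mul_le_mul_of_nonneg_right (cutoff_le_succ k x) (hV0 x))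
        (sub_nonneg.2 (hw1 _ x))
  have hconv (x) : ∃ l, Tendsto (fun k => w k x) atTop (𝓝 l) :=
    ⟨_, tendsto_atTop_ciSup (monotone_nat_of_le_succ fun k => hmono k x)
      ⟨1, by rintro _ ⟨k, rfl⟩; exact hw1 k x⟩⟩
  choose v hv using hconv
  have hv0 (x) : 0 ≤ v x := ge_of_tendsto' (hv x) fun k => hw0 k x
  have hv1 (x) : v x ≤ 1 := le_of_tendsto' (hv x) fun k => hw1 k x
  have hvU (x) : v x ≤ U x := le_of_tendsto' (hv x) fun k => hwU k x
  obtain ⟨hv2, hveq⟩ := contDiff_two_and_lap_eq_of_tendsto (V := V) (v := v) (w := w)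
    (hV.of_le (by norm_cast)) hw
    (fun R => ⟨1, fun k x _ => abs_le.2 ⟨by linarith [hw0 k x], hw1 k x⟩⟩)
    (fun R => by
      obtain ⟨C, hC⟩ := hV.continuous.locBdd.bdd R
      refine ⟨C, fun k x hx => ?_⟩
      rw [hwlap, abs_neg, abs_of_nonneg (mul_nonneg (hcut0 k x) (sub_nonneg.2 (hw1 k x)))]
      have h1 := mul_nonneg (hcut0 k x) (hw0 k x)
      linarith [hcutV k x, le_abs_self (V x), hC x hx]) hv fun x => by
      simp_rw [hwlap]
      simpa using (((tendsto_cutoff x).mul_const (V x)).mul ((hv x).const_sub 1)).neg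
  refine ⟨v, hv2, fun x => ⟨(hv0 x).lt_of_ne fun hx => ?_, hvU x⟩, hveq,
    tendsto_of_tendsto_of_tendsto_of_le_of_le tendsto_const_nhds hUlim hv0 hvU⟩
  have hzero : v = fun _ => 0 := funext <| eq_zero_of_lap_nonpos hv2 hv0
    (fun y => by
      rw [hveq, neg_nonpos]
      exact mul_nonneg (hV0 y) (sub_nonneg.2 (hv1 y))) hx.symm
  obtain ⟨y, hy⟩ := hVne
  have h1 := hveq y
  rw [hzero, lap_const] at h1
  exact hy (by linarith)

end EntireSolution

end Auxiliary

/-- Solvability of `-c_n Δu = R₀` with a positive decaying solution implies property (M):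
existence of a positive decaying solution `v ≤ u` of `-c_n Δv + R₀ v = R₀`. -/
theorem property_M_from_poisson (n : ℕ) (hn : 3 ≤ n)
    (R₀ : EuclideanSpace ℝ (Fin n) → ℝ) (hR₀s : ContDiff ℝ (⊤ : ℕ∞) R₀) (hR₀ : ∀ x, 0 ≤ R₀ x)
    (hR₀ne : ∃ x, R₀ x ≠ 0)
    (u : EuclideanSpace ℝ (Fin n) → ℝ) (hu : ContDiff ℝ 2 u) (hupos : ∀ x, 0 < u x)
    (hueq : ∀ x, -(4 * ((n : ℝ) - 1) / ((n : ℝ) - 2)) * lap u x = R₀ x)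
    (hulim : Tendsto u (cocompact (EuclideanSpace ℝ (Fin n))) (nhds 0)) :
    ∃ v : EuclideanSpace ℝ (Fin n) → ℝ, ContDiff ℝ 2 v ∧
      (∀ x, 0 < v x ∧ v x ≤ u x) ∧
      (∀ x, -(4 * ((n : ℝ) - 1) / ((n : ℝ) - 2)) * lap v x + R₀ x * v x = R₀ x) ∧
      Tendsto v (cocompact (EuclideanSpace ℝ (Fin n))) (nhds 0) := by
  have hn' : (3 : ℝ) ≤ n := by exact_mod_cast hn
  set c : ℝ := 4 * ((n : ℝ) - 1) / ((n : ℝ) - 2)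
  have hc : 0 < c := div_pos (by linarith) (by linarith)
  obtain ⟨v, hv2, hvpos, hveq, hvlim⟩ := exists_solution_of_poisson (V := fun x => c⁻¹ * R₀ x)
    (contDiff_const.mul hR₀s) (fun x => mul_nonneg (inv_nonneg.2 hc.le) (hR₀ x))
    (hR₀ne.imp fun x hx => mul_ne_zero (inv_ne_zero hc.ne') hx) hu (fun x => (hupos x).le)
    (fun x => by rw [← hueq]; field_simp) hulim
  refine ⟨v, hv2, hvpos, fun x => ?_, hvlim⟩
  rw [hveq]
  field_simp
  ring
end
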